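/- arXiv:math/0609019 — 3 statements merged into one kernel-verified Lean document; each statement's English description precedes it below -/
import Mathlib

section
/- Let A ∈ ℤ^{m×n}. Every nonzero g ∈ L(A) = {x ∈ ℤ^n : Ax = 0} admits a conformal decomposition: there exist finitely many (not necessarily distinct) elements g^1,…,g^k ∈ G(A), k ≥ 1, such that g = g^1 + ⋯ + g^k and g^i ⊑ g for every i. -/
open Matrix

noncomputable section

/-- The conformal order `u ⊑ v` on `ℤ^n`. -/
def ConformalTo {n : ℕ} (u v : Fin n → ℤ) : Prop :=
  ∀ i, 0 ≤ u i * v i ∧ |u i| ≤ |v i|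

/-- The Graver basis of `A`: the `⊑`-minimal elements of `{x ∈ ℤ^n : Ax = 0} \ {0}`. -/
def GraverBasis {m n : ℕ} (A : Matrix (Fin m) (Fin n) ℤ) : Set (Fin n → ℤ) :=
  {g | g ≠ 0 ∧ A.mulVec g = 0 ∧
    ∀ h : Fin n → ℤ, h ≠ 0 → A.mulVec h = 0 → ConformalTo h g → h = g}

theorem mul_nonneg_and_abs_le_iff (a b : ℤ) :
    (0 ≤ a * b ∧ |a| ≤ |b|) ↔ (0 ≤ a ∧ a ≤ b) ∨ (b ≤ a ∧ a ≤ 0) := by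
  constructor
  · rintro ⟨h, hab⟩
    rcases lt_trichotomy b 0 with hb | rfl | hb
    · have ha : a ≤ 0 := nonpos_of_mul_nonneg_left h hb
      rw [abs_of_nonpos ha, abs_of_neg hb] at hab
      omega
    · have ha : a = 0 := by simpa using hab
      simp [ha]
    · have ha : 0 ≤ a := nonneg_of_mul_nonneg_left h hb
      rw [abs_of_nonneg ha, abs_of_pos hb] at hab
      omega
  · rintro (⟨h0, h1⟩ | ⟨h1, h0⟩)
    · exact ⟨mul_nonneg h0 (h0.trans h1), abs_le_abs_of_nonneg h0 h1⟩
    · exact ⟨mul_nonneg_of_nonpos_of_nonpos h0 (h1.trans h0), abs_le_abs_of_nonpos h0 h1⟩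

theorem conformalTo_iff {n : ℕ} {u v : Fin n → ℤ} :
    ConformalTo u v ↔ ∀ i, (0 ≤ u i ∧ u i ≤ v i) ∨ (v i ≤ u i ∧ u i ≤ 0) :=
  forall_congr' fun i => mul_nonneg_and_abs_le_iff (u i) (v i)

theorem ConformalTo.refl {n : ℕ} (u : Fin n → ℤ) : ConformalTo u u :=
  fun i => ⟨mul_self_nonneg (u i), le_rfl⟩

theorem ConformalTo.trans {n : ℕ} {u v w : Fin n → ℤ}
    (huv : ConformalTo u v) (hvw : ConformalTo v w) : ConformalTo u w := by
  rw [conformalTo_iff] at *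
  intro i
  have h₁ := huv i
  have h₂ := hvw i
  omega

theorem ConformalTo.sub_self {n : ℕ} {u v : Fin n → ℤ} (h : ConformalTo u v) :
    ConformalTo (v - u) v := by
  rw [conformalTo_iff] at *
  intro i
  have h₁ := h i
  simp only [Pi.sub_apply]
  omega

theorem ConformalTo.sum_natAbs_lt {n : ℕ} {u v : Fin n → ℤ} (h : ConformalTo u v)
    (hne : u ≠ v) : ∑ i, (u i).natAbs < ∑ i, (v i).natAbs := by
  rw [conformalTo_iff] at h
  obtain ⟨j, hj⟩ := Function.ne_iff.mp hne
  refine Finset.sum_lt_sum (fun i _ => ?_) ⟨j, Finset.mem_univ j, ?_⟩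
  · have := h i
    omega
  · have := h j
    omega

/-- Every nonzero element of the lattice `{x ∈ ℤ^n : Ax = 0}` is a conformal sum of
Graver basis elements. -/
theorem conformal_decomposition {m n : ℕ}
    (A : Matrix (Fin m) (Fin n) ℤ) (g : Fin n → ℤ)
    (hg0 : g ≠ 0) (hg : A.mulVec g = 0) :
    ∃ k : ℕ, 1 ≤ k ∧ ∃ f : Fin k → (Fin n → ℤ),
      (∀ i, f i ∈ GraverBasis A ∧ ConformalTo (f i) g) ∧ g = ∑ i, f i := by
  induction hN : ∑ i, (g i).natAbs using Nat.strong_induction_on generalizing g with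
  | _ N ih =>
    subst hN
    by_cases hG : g ∈ GraverBasis A
    · exact ⟨1, le_rfl, fun _ => g, fun _ => ⟨hG, ConformalTo.refl g⟩, by simp⟩
    · have hex : ∃ h : Fin n → ℤ, h ≠ 0 ∧ A.mulVec h = 0 ∧ ConformalTo h g ∧ h ≠ g := by
        by_contra! hmin
        exact hG ⟨hg0, hg, hmin⟩
      obtain ⟨h, h0, hA, hc, hne⟩ := hex
      obtain ⟨k, hk, f, hf, hfs⟩ := ih _ (hc.sum_natAbs_lt hne) h h0 hA rfl
      have hc' := hc.sub_self
      have hne' : g - h ≠ g := by simpa using h0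
      obtain ⟨l, -, f', hf', hfs'⟩ := ih _ (hc'.sum_natAbs_lt hne') (g - h)
        (sub_ne_zero.mpr hne.symm) (by rw [Matrix.mulVec_sub, hg, hA, sub_zero]) rfl
      refine ⟨k + l, by omega, Fin.append f f', fun i => ?_, ?_⟩
      · induction i using Fin.addCases with
        | left i => simpa using ⟨(hf i).1, (hf i).2.trans hc⟩
        | right i => simpa using ⟨(hf' i).1, (hf' i).2.trans hc'⟩
      · simp only [Fin.sum_univ_add, Fin.append_left, Fin.append_right]
        rw [← hfs, ← hfs', add_sub_cancel]
end
end

section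
/- Let A ∈ ℤ^{m×n}, b ∈ ℤ^m, P = conv{x ∈ ℕ^n : Ax = b}, and let u, v ∈ ℕ^n be feasible (Au = Av = b). Suppose u − v = g^1 + ⋯ + g^k with each g^i ∈ ℤ^n satisfying A g^i = 0 and g^i ⊑ u − v. If w ∈ ℝ^n satisfies w·x ≤ w·u for all x ∈ P and w·u = w·v, then w·g^i = 0 for every i, and each point u − g^i lies in P and also maximizes w over P. -/
open Matrix

noncomputable section

/-- Coordinatewise cast of an integer vector to a real vector. -/
def intCast {n : ℕ} (z : Fin n → ℤ) : Fin n → ℝ := fun i => (z i : ℝ)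

/-- The set of nonnegative integer solutions of `Ax = b`, viewed inside `ℝ^n`. -/
def feasSet {m n : ℕ} (A : Matrix (Fin m) (Fin n) ℤ) (b : Fin m → ℤ) : Set (Fin n → ℝ) :=
  {x | ∃ y : Fin n → ℕ, x = (fun i => ((y i : ℝ))) ∧ A.mulVec (fun i => ((y i : ℤ))) = b}

theorem ConformalTo.le_of_sub {n : ℕ} {g u v : Fin n → ℤ} (h : ConformalTo g (u - v))
    (hu : ∀ i, 0 ≤ u i) (hv : ∀ i, 0 ≤ v i) (j : Fin n) : g j ≤ u j := by
  obtain ⟨hsign, habs⟩ := h j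
  rw [Pi.sub_apply] at hsign habs
  have huj := hu j
  have hvj := hv j
  rcases le_or_gt (g j) 0 with hg | hg
  · exact hg.trans huj
  · have hd : 0 ≤ u j - v j := nonneg_of_mul_nonneg_right hsign hg
    rw [abs_of_pos hg, abs_of_nonneg hd] at habs
    linarith

theorem intCast_mem_feasSet {m n : ℕ} {A : Matrix (Fin m) (Fin n) ℤ} {b : Fin m → ℤ}
    {z : Fin n → ℤ} (hz : ∀ i, 0 ≤ z i) (hAz : A.mulVec z = b) :
    intCast z ∈ feasSet A b := by
  lift z to Fin n → ℕ using hz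
  exact ⟨z, by ext i; simp [intCast], hAz⟩

theorem intCast_sub {n : ℕ} (u v : Fin n → ℤ) : intCast (u - v) = intCast u - intCast v := by
  ext i
  simp [intCast]

theorem intCast_sum {n : ℕ} {ι : Type*} (s : Finset ι) (g : ι → Fin n → ℤ) :
    intCast (∑ i ∈ s, g i) = ∑ i ∈ s, intCast (g i) := by
  ext j
  simp [intCast, Finset.sum_apply]

/-- If `u, v` are feasible points maximizing `w` over `P = conv {x ∈ ℕ^n : Ax = b}`, and
`u - v = g¹ + ⋯ + gᵏ` is a conformal decomposition with each `A gⁱ = 0`, then each `w·gⁱ = 0`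
and each `u - gⁱ` lies in `P` and also maximizes `w` over `P`. -/
theorem conformal_summands_on_optimal_face {m n K : ℕ}
    (A : Matrix (Fin m) (Fin n) ℤ) (b : Fin m → ℤ)
    (P : Set (Fin n → ℝ)) (hP : P = convexHull ℝ (feasSet A b))
    (u v : Fin n → ℤ) (hu : ∀ i, 0 ≤ u i) (hv : ∀ i, 0 ≤ v i)
    (hAu : A.mulVec u = b) (hAv : A.mulVec v = b)
    (g : Fin K → (Fin n → ℤ))
    (hsum : u - v = ∑ i, g i)
    (hker : ∀ i, A.mulVec (g i) = 0)
    (hconf : ∀ i, ConformalTo (g i) (u - v))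
    (w : Fin n → ℝ)
    (hmax : ∀ x ∈ P, w ⬝ᵥ x ≤ w ⬝ᵥ intCast u)
    (heq : w ⬝ᵥ intCast u = w ⬝ᵥ intCast v) :
    ∀ i, w ⬝ᵥ intCast (g i) = 0 ∧ intCast (u - g i) ∈ P ∧
      ∀ x ∈ P, w ⬝ᵥ x ≤ w ⬝ᵥ intCast (u - g i) := by
  have hmem : ∀ i, intCast (u - g i) ∈ P := fun i => by
    rw [hP]
    refine subset_convexHull ℝ _ (intCast_mem_feasSet (fun j => ?_) ?_)
    · exact sub_nonneg.2 ((hconf i).le_of_sub hu hv j)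
    · rw [Matrix.mulVec_sub, hAu, hker i, sub_zero]
  have hnonneg : ∀ i, 0 ≤ w ⬝ᵥ intCast (g i) := fun i => by
    have h := hmax _ (hmem i)
    rw [intCast_sub, dotProduct_sub] at h
    linarith
  have hzero : ∑ i, w ⬝ᵥ intCast (g i) = 0 := by
    rw [← dotProduct_sum, ← intCast_sum, ← hsum, intCast_sub, dotProduct_sub, heq, sub_self]
  intro i
  have hi : w ⬝ᵥ intCast (g i) = 0 :=
    (Finset.sum_eq_zero_iff_of_nonneg fun i _ => hnonneg i).1 hzero i (Finset.mem_univ i)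
  refine ⟨hi, hmem i, fun x hx => ?_⟩
  rw [intCast_sub, dotProduct_sub, hi, sub_zero]
  exact hmax x hx
end
end

section
/- Let P ⊂ ℝ^n be a polytope (the convex hull of a finite set) and let E ⊂ ℝ^n be a finite set covering all edge-directions of P. Then the number of vertices of P is at most the number of vertices of the zonotope Z = zone(E); in fact there is a surjection from the vertex set of Z onto the vertex set of P, sending each vertex v of Z with associated functional g_v uniquely maximized over Z at v to the unique maximizer of g_v over P. -/
open Matrix

noncomputable section

/-- `e` is an edge (one-dimensional face) of `P`. -/
def IsEdge {k : ℕ} (P e : Set (Fin k → ℝ)) : Prop :=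
  (∃ w : Fin k → ℝ, e = {x | x ∈ P ∧ ∀ y ∈ P, w ⬝ᵥ y ≤ w ⬝ᵥ x}) ∧
    Module.finrank ℝ ↥(vectorSpan ℝ e) = 1

/-- The zonotope generated by a finite set `E`. -/
def zone {k : ℕ} (E : Finset (Fin k → ℝ)) : Set (Fin k → ℝ) :=
  convexHull ℝ {z | ∃ ε : (Fin k → ℝ) → ℝ, (∀ e, ε e = 1 ∨ ε e = -1) ∧ z = ∑ e ∈ E, ε e • e}

/-- The linear functional `w` is uniquely maximized over `Z` at `v`. -/
def UniqueMax {k : ℕ} (Z : Set (Fin k → ℝ)) (w v : Fin k → ℝ) : Prop :=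
  v ∈ Z ∧ ∀ z ∈ Z, z ≠ v → w ⬝ᵥ z < w ⬝ᵥ v

/-- `v` is a vertex of `Z`: some linear functional is uniquely maximized over `Z` at `v`. -/
def IsVertex {k : ℕ} (Z : Set (Fin k → ℝ)) (v : Fin k → ℝ) : Prop :=
  ∃ w, UniqueMax Z w v

/-- The points of `V` at which the functional `w` is maximal over `V`. -/
def argmaxOn {k : ℕ} (V : Finset (Fin k → ℝ)) (w : Fin k → ℝ) : Finset (Fin k → ℝ) :=
  open Classical in V.filter fun p => ∀ q ∈ V, w ⬝ᵥ q ≤ w ⬝ᵥ p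

section

variable {k : ℕ}

lemma mem_argmaxOn {V : Finset (Fin k → ℝ)} {w p : Fin k → ℝ} :
    p ∈ argmaxOn V w ↔ p ∈ V ∧ ∀ q ∈ V, w ⬝ᵥ q ≤ w ⬝ᵥ p := by
  classical
  simp [argmaxOn]

lemma argmaxOn_nonempty {V : Finset (Fin k → ℝ)} (hV : V.Nonempty) (w : Fin k → ℝ) :
    ∃ p, p ∈ argmaxOn V w := by
  obtain ⟨p, hp, h⟩ := V.exists_max_image (fun q => w ⬝ᵥ q) hV
  exact ⟨p, mem_argmaxOn.2 ⟨hp, h⟩⟩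

lemma continuous_dotProduct_right (p : Fin k → ℝ) : Continuous fun w : Fin k → ℝ => w ⬝ᵥ p := by
  fun_prop

lemma dotProduct_lt_of_norm_max {x y : Fin k → ℝ} (hxy : y ≠ x) (h : y ⬝ᵥ y ≤ x ⬝ᵥ x) :
    x ⬝ᵥ y < x ⬝ᵥ x := by
  have h1 : 0 < (x - y) ⬝ᵥ (x - y) := by
    refine lt_of_le_of_ne (Finset.sum_nonneg fun i _ => mul_self_nonneg _) fun h0 => hxy ?_
    exact (sub_eq_zero.1 (dotProduct_self_eq_zero.1 h0.symm)).symm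
  simp only [sub_dotProduct, dotProduct_sub, dotProduct_comm y x] at h1
  linarith

/-- Rotating a functional that is uniquely maximal at `x` around `x`, keeping `y` below, until it
meets a further point. -/
lemma exists_rotated_functional {G : Finset (Fin k → ℝ)} {x y z : Fin k → ℝ}
    (hx : ∀ p ∈ G, p ⬝ᵥ p ≤ x ⬝ᵥ x) (hy : y ∈ G) (hz : z ∈ G) (hyx : y ≠ x)
    (hncol : ∀ r : ℝ, z - x ≠ r • (y - x)) :
    ∃ c : Fin k → ℝ, (∀ p ∈ G, c ⬝ᵥ p ≤ c ⬝ᵥ x) ∧ (∃ p ∈ G, p ≠ x ∧ c ⬝ᵥ p = c ⬝ᵥ x) ∧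
      c ⬝ᵥ y < c ⬝ᵥ x := by
  classical
  set a := z - x with ha
  set b := y - x with hb
  have hbb : 0 < b ⬝ᵥ b := by
    refine lt_of_le_of_ne (Finset.sum_nonneg fun i _ => mul_self_nonneg _) fun h0 => hyx ?_
    exact sub_eq_zero.1 (dotProduct_self_eq_zero.1 h0.symm)
  set d := a - ((a ⬝ᵥ b) / (b ⬝ᵥ b)) • b with hd
  have hdb : d ⬝ᵥ b = 0 := by
    simp only [hd, sub_dotProduct, smul_dotProduct, smul_eq_mul]
    field_simp
    ring
  have hda : 0 < d ⬝ᵥ a := by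
    have h1 : d ⬝ᵥ d = d ⬝ᵥ a := by
      conv_lhs => rhs; rw [hd]
      rw [dotProduct_sub, dotProduct_smul, hdb]
      simp
    rw [← h1]
    refine lt_of_le_of_ne (Finset.sum_nonneg fun i _ => mul_self_nonneg _) fun h0 => ?_
    exact hncol _ (sub_eq_zero.1 (dotProduct_self_eq_zero.1 h0.symm))
  obtain ⟨m, hm, hmin⟩ := (G.filter fun p => 0 < d ⬝ᵥ (p - x)).exists_min_image
    (fun p => (x ⬝ᵥ x - x ⬝ᵥ p) / (d ⬝ᵥ (p - x))) ⟨z, Finset.mem_filter.2 ⟨hz, hda⟩⟩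
  simp only [Finset.mem_filter] at hm hmin
  have hmx : m ≠ x := by
    rintro rfl
    simp at hm
  set t := (x ⬝ᵥ x - x ⬝ᵥ m) / (d ⬝ᵥ (m - x)) with ht
  have ht0 : 0 ≤ t :=
    div_nonneg (sub_nonneg.2 (dotProduct_lt_of_norm_max hmx (hx _ hm.1)).le) hm.2.le
  have key : ∀ p, (x + t • d) ⬝ᵥ p - (x + t • d) ⬝ᵥ x
      = t * (d ⬝ᵥ (p - x)) - (x ⬝ᵥ x - x ⬝ᵥ p) := by
    intro p
    simp only [add_dotProduct, smul_dotProduct, smul_eq_mul, dotProduct_sub]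
    ring
  refine ⟨x + t • d, fun p hp => ?_, ⟨m, hm.1, hmx, ?_⟩, ?_⟩
  · rw [← sub_nonpos, key]
    rcases lt_or_ge 0 (d ⬝ᵥ (p - x)) with h | h
    · have := hmin p ⟨hp, h⟩
      rw [le_div_iff₀ h] at this
      linarith
    · have h1 : x ⬝ᵥ p ≤ x ⬝ᵥ x := by
        rcases eq_or_ne p x with rfl | hpx
        · exact le_rfl
        · exact (dotProduct_lt_of_norm_max hpx (hx _ hp)).le
      nlinarith
  · rw [← sub_eq_zero, key, ht, div_mul_cancel₀ _ hm.2.ne', sub_self]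
  · rw [← sub_neg, key, ← hb, hdb]
    have := dotProduct_lt_of_norm_max hyx (hx _ hy)
    linarith

lemma exists_perturbation (V : Finset (Fin k → ℝ)) (w c : Fin k → ℝ) (x : Fin k → ℝ)
    (hx : x ∈ argmaxOn V w) (hc : ∀ p ∈ argmaxOn V w, c ⬝ᵥ p ≤ c ⬝ᵥ x) :
    ∃ w' : Fin k → ℝ, ∀ p, p ∈ argmaxOn V w' ↔ p ∈ argmaxOn V w ∧ c ⬝ᵥ p = c ⬝ᵥ x := by
  have hx' := mem_argmaxOn.1 hx
  have hev : ∀ᶠ ε : ℝ in nhdsWithin 0 (Set.Ioi 0), ∀ p ∈ V, w ⬝ᵥ p < w ⬝ᵥ x →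
      (w + ε • c) ⬝ᵥ p < (w + ε • c) ⬝ᵥ x := by
    rw [Filter.eventually_all_finset]
    intro p _
    by_cases h : w ⬝ᵥ p < w ⬝ᵥ x
    · have h1 : ∀ᶠ ε : ℝ in nhds 0, (w + ε • c) ⬝ᵥ p < (w + ε • c) ⬝ᵥ x := by
        refine (isOpen_lt ?_ ?_).mem_nhds (by simpa using h)
        · exact (continuous_dotProduct_right p).comp (by fun_prop)
        · exact (continuous_dotProduct_right x).comp (by fun_prop)
      filter_upwards [nhdsWithin_le_nhds h1] with ε hε _ using hε
    · exact Filter.Eventually.of_forall fun _ h' => absurd h' h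
  obtain ⟨ε, hε, hε0⟩ := (hev.and self_mem_nhdsWithin).exists
  have hε0 : 0 < ε := hε0
  have hle : ∀ p ∈ V, (w + ε • c) ⬝ᵥ p ≤ (w + ε • c) ⬝ᵥ x := by
    intro p hp
    rcases (hx'.2 p hp).lt_or_eq with h | h
    · exact (hε p hp h).le
    · have := hc p (mem_argmaxOn.2 ⟨hp, fun q hq => h ▸ hx'.2 q hq⟩)
      simp only [add_dotProduct, smul_dotProduct, smul_eq_mul]
      nlinarith
  refine ⟨w + ε • c, fun p => ⟨fun hp => ?_, fun hp => ?_⟩⟩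
  · have hp' := mem_argmaxOn.1 hp
    have hxp := hp'.2 x hx'.1
    have hwp : w ⬝ᵥ p = w ⬝ᵥ x := by
      rcases (hx'.2 p hp'.1).lt_or_eq with h | h
      · exact absurd (hε p hp'.1 h) hxp.not_gt
      · exact h
    have hpw : p ∈ argmaxOn V w := mem_argmaxOn.2 ⟨hp'.1, fun q hq => hwp ▸ hx'.2 q hq⟩
    refine ⟨hpw, le_antisymm (hc p hpw) ?_⟩
    simp only [add_dotProduct, smul_dotProduct, smul_eq_mul, hwp] at hxp
    exact le_of_mul_le_mul_left (by linarith) hε0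
  · have hp' := mem_argmaxOn.1 hp.1
    refine mem_argmaxOn.2 ⟨hp'.1, fun q hq => (hle q hq).trans_eq ?_⟩
    have := le_antisymm (hx'.2 p hp'.1) (hp'.2 x hx'.1)
    simp only [add_dotProduct, smul_dotProduct, smul_eq_mul, this, hp.2]

/-- A functional with two maximizers has a perturbation whose maximizers are maximizers of the
original functional and span a line. -/
lemma exists_collinear_argmaxOn (V : Finset (Fin k → ℝ)) (w : Fin k → ℝ)
    (hw : 1 < (argmaxOn V w).card) :
    ∃ w' : Fin k → ℝ, argmaxOn V w' ⊆ argmaxOn V w ∧ ∃ x ∈ argmaxOn V w', ∃ y ∈ argmaxOn V w',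
      y ≠ x ∧ ∀ z ∈ argmaxOn V w', ∃ r : ℝ, z - x = r • (y - x) := by
  induction h : (argmaxOn V w).card using Nat.strong_induction_on generalizing w with
  | _ m ih =>
    obtain ⟨x, hx, hmax⟩ := (argmaxOn V w).exists_max_image (fun p => p ⬝ᵥ p)
      (Finset.card_pos.1 (by omega))
    obtain ⟨y, hy, hyx⟩ := Finset.exists_mem_ne hw x
    by_cases hcol : ∀ z ∈ argmaxOn V w, ∃ r : ℝ, z - x = r • (y - x)
    · exact ⟨w, subset_rfl, x, hx, y, hy, hyx, hcol⟩
    · push Not at hcol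
      obtain ⟨z, hz, hzn⟩ := hcol
      obtain ⟨c, hc, ⟨p, hp, hpx, hcp⟩, hcy⟩ := exists_rotated_functional hmax hy hz hyx hzn
      obtain ⟨w', hw'⟩ := exists_perturbation V w c x hx hc
      have hsub : argmaxOn V w' ⊆ argmaxOn V w := fun q hq => ((hw' q).1 hq).1
      have hlt : (argmaxOn V w').card < m := by
        rw [← h]
        refine Finset.card_lt_card ⟨hsub, fun hs => ?_⟩
        exact hcy.ne ((hw' y).1 (hs hy)).2
      have hone : 1 < (argmaxOn V w').card :=
        Finset.one_lt_card.2 ⟨p, (hw' p).2 ⟨hp, hcp⟩, x, (hw' x).2 ⟨hx, rfl⟩, hpx⟩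
      obtain ⟨w'', h1, h2⟩ := ih _ hlt w' hone rfl
      exact ⟨w'', h1.trans hsub, h2⟩

lemma dotProduct_le_of_mem_convexHull {S : Set (Fin k → ℝ)} {w z : Fin k → ℝ} {M : ℝ}
    (h : ∀ q ∈ S, w ⬝ᵥ q ≤ M) (hz : z ∈ convexHull ℝ S) : w ⬝ᵥ z ≤ M :=
  convexHull_min (t := {q | w ⬝ᵥ q ≤ M}) h
    (convex_halfSpace_le ⟨dotProduct_add w, fun c x => dotProduct_smul c w x⟩ M) hz

/-- The face of a polytope in direction `w` is the convex hull of the generators it contains. -/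
lemma face_convexHull_eq (V : Finset (Fin k → ℝ)) (w : Fin k → ℝ) :
    {x | x ∈ convexHull ℝ (V : Set (Fin k → ℝ)) ∧
      ∀ y ∈ convexHull ℝ (V : Set (Fin k → ℝ)), w ⬝ᵥ y ≤ w ⬝ᵥ x} =
      convexHull ℝ (argmaxOn V w : Set (Fin k → ℝ)) := by
  classical
  ext x
  constructor
  · rintro ⟨hx, hmax⟩
    obtain ⟨l, hl0, hl1, hlx⟩ := Finset.mem_convexHull'.1 hx
    have hV : ∀ y ∈ V, w ⬝ᵥ y ≤ w ⬝ᵥ x := fun y hy => hmax y (subset_convexHull ℝ _ hy)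
    have hsum : ∑ y ∈ V, l y * (w ⬝ᵥ x - w ⬝ᵥ y) = 0 := by
      have : w ⬝ᵥ x = ∑ y ∈ V, l y * (w ⬝ᵥ y) := by
        conv_lhs => rw [← hlx, dotProduct_sum]
        simp
      simp only [mul_sub, Finset.sum_sub_distrib, ← Finset.sum_mul, hl1, one_mul]
      rw [← this, sub_self]
    have hzero : ∀ y ∈ V, l y * (w ⬝ᵥ x - w ⬝ᵥ y) = 0 :=
      (Finset.sum_eq_zero_iff_of_nonneg fun y hy =>
        mul_nonneg (hl0 y hy) (sub_nonneg.2 (hV y hy))).1 hsum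
    have hout : ∀ y ∈ V, y ∉ argmaxOn V w → l y = 0 := by
      intro y hy hny
      rcases mul_eq_zero.1 (hzero y hy) with h | h
      · exact h
      · refine absurd (mem_argmaxOn.2 ⟨hy, fun q hq => ?_⟩) hny
        linarith [hV q hq]
    have hsub : argmaxOn V w ⊆ V := fun y hy => (mem_argmaxOn.1 hy).1
    refine Finset.mem_convexHull'.2 ⟨l, fun y hy => hl0 y (hsub hy), ?_, ?_⟩
    · rw [← hl1]
      exact Finset.sum_subset hsub hout
    · rw [← hlx]
      exact Finset.sum_subset hsub fun y hy hny => by rw [hout y hy hny, zero_smul]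
  · intro hx
    have hsub : (argmaxOn V w : Set (Fin k → ℝ)) ⊆ V := fun y hy => (mem_argmaxOn.1 hy).1
    refine ⟨convexHull_mono hsub hx, fun y hy => dotProduct_le_of_mem_convexHull ?_ hy⟩
    intro q hq
    have h := dotProduct_le_of_mem_convexHull (w := -w) (M := -(w ⬝ᵥ q)) (fun p hp => by
      rw [neg_dotProduct, neg_le_neg_iff]
      exact (mem_argmaxOn.1 hp).2 q hq) hx
    rwa [neg_dotProduct, neg_le_neg_iff] at h

lemma isEdge_face {V : Finset (Fin k → ℝ)} {w x y : Fin k → ℝ} (hx : x ∈ argmaxOn V w)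
    (hy : y ∈ argmaxOn V w) (hyx : y ≠ x)
    (hcol : ∀ z ∈ argmaxOn V w, ∃ r : ℝ, z - x = r • (y - x)) :
    IsEdge (convexHull ℝ (V : Set (Fin k → ℝ)))
      (convexHull ℝ (argmaxOn V w : Set (Fin k → ℝ))) := by
  refine ⟨⟨w, (face_convexHull_eq V w).symm⟩, ?_⟩
  rw [← direction_affineSpan, affineSpan_convexHull, direction_affineSpan]
  apply le_antisymm
  · rw [← collinear_iff_finrank_le_one]
    refine (collinear_iff_of_mem (Finset.mem_coe.2 hx)).2 ⟨y - x, fun z hz => ?_⟩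
    obtain ⟨r, hr⟩ := hcol z hz
    exact ⟨r, by rw [← hr]; simp⟩
  · rw [Nat.one_le_iff_ne_zero, ne_eq, Submodule.finrank_eq_zero]
    intro hbot
    have : y - x ∈ vectorSpan ℝ (argmaxOn V w : Set (Fin k → ℝ)) :=
      vsub_mem_vectorSpan ℝ (Finset.mem_coe.2 hy) (Finset.mem_coe.2 hx)
    rw [hbot, Submodule.mem_bot, sub_eq_zero] at this
    exact hyx this

/-- If `E` covers all edge-directions of a polytope, a functional vanishing on no nonzero element
of `E` has at most one maximizer. -/
lemma card_argmaxOn_le_one {V E : Finset (Fin k → ℝ)}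
    (hE : ∀ e : Set (Fin k → ℝ), IsEdge (convexHull ℝ (V : Set (Fin k → ℝ))) e →
      ∃ g ∈ E, ∃ u ∈ e, ∃ v ∈ e, u ≠ v ∧ ∃ lam : ℝ, lam ≠ 0 ∧ g = lam • (u - v))
    {w : Fin k → ℝ} (hw : ∀ e ∈ E, e ≠ 0 → w ⬝ᵥ e ≠ 0) : (argmaxOn V w).card ≤ 1 := by
  by_contra! h
  obtain ⟨w', hsub, x, hx, y, hy, hyx, hcol⟩ := exists_collinear_argmaxOn V w h
  obtain ⟨g, hg, u, hu, v, hv, huv, l, hl, rfl⟩ := hE _ (isEdge_face hx hy hyx hcol)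
  have hface : ∀ p ∈ convexHull ℝ (argmaxOn V w' : Set (Fin k → ℝ)),
      p ∈ convexHull ℝ (V : Set (Fin k → ℝ)) ∧
      ∀ q ∈ convexHull ℝ (V : Set (Fin k → ℝ)), w ⬝ᵥ q ≤ w ⬝ᵥ p := fun p hp =>
    (face_convexHull_eq V w).ge (convexHull_mono (Finset.coe_subset.2 hsub) hp)
  have heq := le_antisymm ((hface v hv).2 u (hface u hu).1) ((hface u hu).2 v (hface v hv).1)
  refine hw _ hg (smul_ne_zero hl (sub_ne_zero.2 huv)) ?_
  rw [dotProduct_smul, dotProduct_sub, heq, sub_self, smul_zero]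

lemma UniqueMax.eq {S : Set (Fin k → ℝ)} {w u v : Fin k → ℝ} (hu : UniqueMax S w u)
    (hv : UniqueMax S w v) : u = v := by
  by_contra h
  exact lt_asymm (hu.2 v hv.1 (Ne.symm h)) (hv.2 u hu.1 h)

lemma UniqueMax.convexHull {S : Set (Fin k → ℝ)} {w v : Fin k → ℝ} (h : UniqueMax S w v) :
    UniqueMax (convexHull ℝ S) w v := by
  refine ⟨subset_convexHull ℝ S h.1, fun z hz hzv => ?_⟩
  have hconv : Convex ℝ {q | q ≠ v → w ⬝ᵥ q < w ⬝ᵥ v} := by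
    rw [convex_iff_forall_pos]
    intro p hp q hq a b ha hb hab hne
    simp only [Set.mem_ofPred_eq] at hp hq
    have hv : w ⬝ᵥ v = a * (w ⬝ᵥ v) + b * (w ⬝ᵥ v) := by rw [← add_mul, hab, one_mul]
    rw [hv]
    simp only [dotProduct_add, dotProduct_smul, smul_eq_mul]
    by_cases hpv : p = v
    · by_cases hqv : q = v
      · exact absurd (by rw [hpv, hqv, ← add_smul, hab, one_smul]) hne
      · have := mul_lt_mul_of_pos_left (hq hqv) hb
        rw [hpv]
        linarith
    · have h1 := mul_lt_mul_of_pos_left (hp hpv) ha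
      have h2 : w ⬝ᵥ q ≤ w ⬝ᵥ v := by
        by_cases hqv : q = v
        · rw [hqv]
        · exact (hq hqv).le
      have := mul_le_mul_of_nonneg_left h2 hb.le
      linarith
  exact convexHull_min (fun q hq => h.2 q hq) hconv hz hzv

lemma uniqueMax_of_mem_argmaxOn {V : Finset (Fin k → ℝ)} {w u : Fin k → ℝ}
    (hcard : (argmaxOn V w).card ≤ 1) (hu : u ∈ argmaxOn V w) :
    UniqueMax (convexHull ℝ (V : Set (Fin k → ℝ))) w u := by
  refine UniqueMax.convexHull ⟨(mem_argmaxOn.1 hu).1, fun z hz hzu => ?_⟩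
  refine lt_of_le_of_ne ((mem_argmaxOn.1 hu).2 z hz) fun heq => hzu ?_
  exact Finset.card_le_one.1 hcard z
    (mem_argmaxOn.2 ⟨hz, fun q hq => heq ▸ (mem_argmaxOn.1 hu).2 q hq⟩) u hu

lemma UniqueMax.mem_argmaxOn {V : Finset (Fin k → ℝ)} (hV : V.Nonempty) {w u : Fin k → ℝ}
    (h : UniqueMax (_root_.convexHull ℝ (V : Set (Fin k → ℝ))) w u) : u ∈ argmaxOn V w := by
  obtain ⟨p, hp⟩ := argmaxOn_nonempty hV w
  have hp' := _root_.mem_argmaxOn.1 hp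
  suffices u = p by rwa [this]
  by_contra hne
  exact (dotProduct_le_of_mem_convexHull hp'.2 h.1).not_gt
    (h.2 p (subset_convexHull ℝ _ hp'.1) (Ne.symm hne))

/-- Functionals with the same nonzero signs on `E` have the same maximizers over `V`. -/
lemma mem_argmaxOn_of_same_signs {V E : Finset (Fin k → ℝ)} (hV : V.Nonempty)
    (hE : ∀ w : Fin k → ℝ, (∀ e ∈ E, e ≠ 0 → w ⬝ᵥ e ≠ 0) → (argmaxOn V w).card ≤ 1)
    {g w u : Fin k → ℝ} (hgw : ∀ e ∈ E, e ≠ 0 → 0 < (g ⬝ᵥ e) * (w ⬝ᵥ e))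
    (hu : u ∈ argmaxOn V w) : u ∈ argmaxOn V g := by
  classical
  have hclosed : ∀ p, IsClosed {f : Fin k → ℝ | ∀ q ∈ V, f ⬝ᵥ q ≤ f ⬝ᵥ p} := by
    intro p
    simp only [Set.ofPred_forall]
    exact isClosed_biInter fun q _ =>
      isClosed_le (continuous_dotProduct_right q) (continuous_dotProduct_right p)
  set C : Set (Fin k → ℝ) := {f | ∀ e ∈ E, e ≠ 0 → 0 < (g ⬝ᵥ e) * (f ⬝ᵥ e)} with hC
  have hconv : Convex ℝ C := by
    rw [convex_iff_forall_pos]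
    intro p hp q hq a b ha hb _ e he he0
    have h1 := mul_pos ha (hp e he he0)
    have h2 := mul_pos hb (hq e he he0)
    simp only [add_dotProduct, smul_dotProduct, smul_eq_mul]
    linarith
  have hgC : g ∈ C := fun e he he0 =>
    mul_self_pos.2 (left_ne_zero_of_mul (hgw e he he0).ne')
  obtain ⟨p, hp⟩ := argmaxOn_nonempty hV g
  by_cases hpu : p = u
  · rwa [← hpu]
  have hmemA := mem_argmaxOn.1 hu
  have hmemp := mem_argmaxOn.1 hp
  obtain ⟨f, hfC, hfA, hfB⟩ := isPreconnected_closed_iff.1 hconv.isPreconnected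
    {f | ∀ q ∈ V, f ⬝ᵥ q ≤ f ⬝ᵥ u} (⋃ r ∈ V.erase u, {f | ∀ q ∈ V, f ⬝ᵥ q ≤ f ⬝ᵥ r})
    (hclosed u) (isClosed_biUnion_finset fun r _ => hclosed r)
    (fun f _ => by
      obtain ⟨r, hr⟩ := argmaxOn_nonempty hV f
      have hr' := mem_argmaxOn.1 hr
      by_cases hru : r = u
      · exact Or.inl (hru ▸ hr'.2)
      · exact Or.inr (Set.mem_biUnion (Finset.mem_coe.2 (Finset.mem_erase.2 ⟨hru, hr'.1⟩)) hr'.2))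
    ⟨w, hgw, hmemA.2⟩
    ⟨g, hgC, Set.mem_biUnion (Finset.mem_coe.2 (Finset.mem_erase.2 ⟨hpu, hmemp.1⟩)) hmemp.2⟩
  obtain ⟨r, hr, hfr⟩ := Set.mem_iUnion₂.1 hfB
  obtain ⟨hru, hrV⟩ := Finset.mem_erase.1 hr
  exact absurd (Finset.card_le_one.1
    (hE f fun e he he0 => right_ne_zero_of_mul (hfC e he he0).ne') r
    (mem_argmaxOn.2 ⟨hrV, hfr⟩) u (mem_argmaxOn.2 ⟨hmemA.1, hfA⟩)) hru

lemma exists_generic_mem (E : Finset (Fin k → ℝ)) {U : Set (Fin k → ℝ)} (hU : IsOpen U)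
    (hne : U.Nonempty) : ∃ w ∈ U, ∀ e ∈ E, e ≠ 0 → w ⬝ᵥ e ≠ 0 := by
  classical
  induction E using Finset.induction_on generalizing U with
  | empty => exact hne.imp fun w hw => ⟨hw, by simp⟩
  | insert e E _ ih =>
    by_cases he : e = 0
    · obtain ⟨w, hw, h⟩ := ih hU hne
      exact ⟨w, hw, fun f hf hf0 => h f (Finset.mem_of_mem_insert_of_ne hf (he ▸ hf0)) hf0⟩
    have hopen : IsOpen {w : Fin k → ℝ | w ⬝ᵥ e ≠ 0} :=
      isOpen_ne_fun (continuous_dotProduct_right e) continuous_const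
    have hne' : (U ∩ {w : Fin k → ℝ | w ⬝ᵥ e ≠ 0}).Nonempty := by
      obtain ⟨w, hw⟩ := hne
      by_cases hwe : w ⬝ᵥ e = 0
      · have h1 : ∀ᶠ ε : ℝ in nhds 0, w + ε • e ∈ U :=
          (hU.preimage (f := fun ε : ℝ => w + ε • e) (by fun_prop)).mem_nhds (by simpa using hw)
        obtain ⟨ε, hε, hε0⟩ :=
          ((h1.filter_mono (nhdsWithin_le_nhds (s := Set.Ioi 0))).and self_mem_nhdsWithin).exists
        refine ⟨w + ε • e, hε, ?_⟩
        simp only [Set.mem_ofPred_eq, add_dotProduct, smul_dotProduct, hwe, zero_add, smul_eq_mul]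
        exact mul_ne_zero (ne_of_gt hε0) fun h => he (dotProduct_self_eq_zero.1 h)
      · exact ⟨w, hw, hwe⟩
    obtain ⟨w, ⟨hw, hwe⟩, h⟩ := ih (hU.inter hopen) hne'
    refine ⟨w, hw, fun f hf hf0 => ?_⟩
    rcases Finset.mem_insert.1 hf with rfl | hf
    · exact hwe
    · exact h f hf hf0

/-- The functionals uniquely maximized at a vertex of a polytope include a generic one. -/
lemma exists_generic_uniqueMax (V E : Finset (Fin k → ℝ)) (hV : V.Nonempty) {u : Fin k → ℝ}
    (hu : IsVertex (convexHull ℝ (V : Set (Fin k → ℝ))) u) :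
    ∃ w : Fin k → ℝ, u ∈ argmaxOn V w ∧ ∀ e ∈ E, e ≠ 0 → w ⬝ᵥ e ≠ 0 := by
  obtain ⟨w₀, hw₀⟩ := hu
  have huV := (mem_argmaxOn.1 (hw₀.mem_argmaxOn hV)).1
  have hopen : IsOpen {w : Fin k → ℝ | ∀ q ∈ V, q ≠ u → w ⬝ᵥ q < w ⬝ᵥ u} := by
    simp only [Set.ofPred_forall]
    exact isOpen_biInter_finset fun q _ => isOpen_iInter_of_finite fun _ =>
      isOpen_lt (continuous_dotProduct_right q) (continuous_dotProduct_right u)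
  obtain ⟨w, hw, hgen⟩ := exists_generic_mem E hopen
    ⟨w₀, fun q hq hqu => hw₀.2 q (subset_convexHull ℝ _ hq) hqu⟩
  refine ⟨w, mem_argmaxOn.2 ⟨huV, fun q hq => ?_⟩, hgen⟩
  by_cases hqu : q = u
  · rw [hqu]
  · exact (hw q hq hqu).le

/-- A choice of signs of the values of `w`. -/
def signChoice (w e : Fin k → ℝ) : ℝ := if 0 ≤ w ⬝ᵥ e then 1 else -1

lemma signChoice_eq (w e : Fin k → ℝ) : signChoice w e = 1 ∨ signChoice w e = -1 := by
  unfold signChoice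
  split_ifs <;> simp

lemma signChoice_mul (w e : Fin k → ℝ) : signChoice w e * (w ⬝ᵥ e) = |w ⬝ᵥ e| := by
  unfold signChoice
  split_ifs with h
  · rw [one_mul, abs_of_nonneg h]
  · rw [abs_of_neg (not_le.1 h), neg_one_mul]

lemma dotProduct_sum_smul (E : Finset (Fin k → ℝ)) (w : Fin k → ℝ) (ε : (Fin k → ℝ) → ℝ) :
    w ⬝ᵥ (∑ e ∈ E, ε e • e) = ∑ e ∈ E, ε e * (w ⬝ᵥ e) := by
  simp [dotProduct_sum]

lemma sign_mul_le_abs {s : ℝ} (hs : s = 1 ∨ s = -1) (x : ℝ) : s * x ≤ |x| := by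
  rcases hs with rfl | rfl
  · simpa using le_abs_self x
  · simpa using neg_le_abs x

lemma sum_smul_mem_zone (E : Finset (Fin k → ℝ)) {ε : (Fin k → ℝ) → ℝ}
    (hε : ∀ e, ε e = 1 ∨ ε e = -1) : ∑ e ∈ E, ε e • e ∈ zone E :=
  subset_convexHull ℝ _ ⟨ε, hε, rfl⟩

lemma dotProduct_le_of_mem_zone {E : Finset (Fin k → ℝ)} (w : Fin k → ℝ) {z : Fin k → ℝ}
    (hz : z ∈ zone E) : w ⬝ᵥ z ≤ ∑ e ∈ E, |w ⬝ᵥ e| := by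
  refine dotProduct_le_of_mem_convexHull ?_ hz
  rintro _ ⟨ε, hε, rfl⟩
  rw [dotProduct_sum_smul]
  exact Finset.sum_le_sum fun e _ => sign_mul_le_abs (hε e) _

lemma UniqueMax.eq_sum_of_zone {E : Finset (Fin k → ℝ)} {w v : Fin k → ℝ}
    (h : UniqueMax (zone E) w v) {ε : (Fin k → ℝ) → ℝ} (hε : ∀ e, ε e = 1 ∨ ε e = -1)
    (hεw : ∀ e ∈ E, ε e * (w ⬝ᵥ e) = |w ⬝ᵥ e|) : ∑ e ∈ E, ε e • e = v := by
  by_contra hne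
  have h1 := h.2 _ (sum_smul_mem_zone E hε) hne
  rw [dotProduct_sum_smul, Finset.sum_congr rfl hεw] at h1
  exact (dotProduct_le_of_mem_zone w h.1).not_gt h1

lemma UniqueMax.dotProduct_ne_zero_of_zone {E : Finset (Fin k → ℝ)} {w v : Fin k → ℝ}
    (h : UniqueMax (zone E) w v) : ∀ e ∈ E, e ≠ 0 → w ⬝ᵥ e ≠ 0 := by
  classical
  intro e he he0 hwe
  have h1 := h.eq_sum_of_zone (signChoice_eq w) fun e _ => signChoice_mul w e
  have h2 := h.eq_sum_of_zone (ε := Function.update (signChoice w) e (-1))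
    (fun f => by
      rcases eq_or_ne f e with rfl | hf
      · simp
      · simpa [hf] using signChoice_eq w f)
    (fun f _ => by
      rcases eq_or_ne f e with rfl | hf
      · simp [hwe]
      · simpa [hf] using signChoice_mul w f)
  rw [← h2, ← Finset.add_sum_erase E _ he, ← Finset.add_sum_erase E _ he,
    Finset.sum_congr (g := fun f => signChoice w f • f) rfl
      (f := fun f => Function.update (signChoice w) e (-1) f • f)
      (fun f hf => by rw [Function.update_of_ne (Finset.ne_of_mem_erase hf)])] at h1
  have h3 := add_right_cancel h1
  simp only [signChoice, hwe, le_refl, if_true, Function.update_self, one_smul, neg_smul] at h3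
  exact he0 (self_eq_neg.1 h3)

lemma uniqueMax_zone_of_generic {E : Finset (Fin k → ℝ)} {w : Fin k → ℝ}
    (hw : ∀ e ∈ E, e ≠ 0 → w ⬝ᵥ e ≠ 0) :
    UniqueMax (zone E) w (∑ e ∈ E, signChoice w e • e) := by
  refine UniqueMax.convexHull ⟨⟨_, signChoice_eq w, rfl⟩, ?_⟩
  rintro _ ⟨ε, hε, rfl⟩ hne
  obtain ⟨e, he, hee⟩ := Finset.exists_ne_zero_of_sum_ne_zero (s := E)
    (f := fun e => ε e • e - signChoice w e • e)
    (by rwa [Finset.sum_sub_distrib, sub_ne_zero])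
  rw [← sub_smul] at hee
  have hwe := hw e he (right_ne_zero_of_smul hee)
  rw [dotProduct_sum_smul, dotProduct_sum_smul]
  simp only [signChoice_mul]
  refine Finset.sum_lt_sum (fun e _ => sign_mul_le_abs (hε e) _) ⟨e, he, ?_⟩
  refine lt_of_le_of_ne (sign_mul_le_abs (hε e) _) fun heq => left_ne_zero_of_smul hee ?_
  rw [← signChoice_mul] at heq
  exact sub_eq_zero.2 (mul_right_cancel₀ hwe heq)

/-- Functionals uniquely maximized at the same vertex of `zone E` have the same signs on `E`. -/
lemma UniqueMax.same_signs_of_zone {E : Finset (Fin k → ℝ)} {g w v : Fin k → ℝ}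
    (hg : UniqueMax (zone E) g v) (hw : UniqueMax (zone E) w v) :
    ∀ e ∈ E, e ≠ 0 → 0 < (g ⬝ᵥ e) * (w ⬝ᵥ e) := by
  have h1 := hg.eq_sum_of_zone (signChoice_eq g) fun e _ => signChoice_mul g e
  have h2 := hw.eq_sum_of_zone (signChoice_eq w) fun e _ => signChoice_mul w e
  have h3 : ∑ e ∈ E, signChoice g e * (w ⬝ᵥ e) = ∑ e ∈ E, |w ⬝ᵥ e| := by
    rw [← dotProduct_sum_smul, h1, ← h2, dotProduct_sum_smul]
    exact Finset.sum_congr rfl fun e _ => signChoice_mul w e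
  have h4 := (Finset.sum_eq_sum_iff_of_le fun e _ =>
    sign_mul_le_abs (signChoice_eq g e) (w ⬝ᵥ e)).1 h3
  intro e he he0
  have hge := hg.dotProduct_ne_zero_of_zone e he he0
  have hwe := hw.dotProduct_ne_zero_of_zone e he he0
  have h5 : (signChoice g e * (g ⬝ᵥ e)) * (signChoice g e * (w ⬝ᵥ e)) =
      (g ⬝ᵥ e) * (w ⬝ᵥ e) := by
    rcases signChoice_eq g e with h | h <;> rw [h] <;> ring
  rw [← h5, h4 e he, signChoice_mul]
  positivity

lemma finite_vertices_zone (E : Finset (Fin k → ℝ)) : {v | IsVertex (zone E) v}.Finite := by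
  classical
  refine (E.powerset.image fun A => ∑ e ∈ E, (if e ∈ A then (1 : ℝ) else -1) • e).finite_toSet.subset
    ?_
  rintro v ⟨w, hw⟩
  have h1 := hw.eq_sum_of_zone (signChoice_eq w) fun e _ => signChoice_mul w e
  refine Finset.mem_coe.2 (Finset.mem_image.2
    ⟨E.filter fun e => 0 ≤ w ⬝ᵥ e, Finset.mem_powerset.2 (Finset.filter_subset _ _), ?_⟩)
  rw [← h1]
  exact Finset.sum_congr rfl fun e he => by simp [signChoice, he]

end

/-- The map sending a vertex `v` of the zonotope `Z = zone E`, with associated functional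
`gv v` uniquely maximized over `Z` at `v`, to the unique maximizer of `gv v` over `P` is a
surjection onto the vertex set of `P`; in particular `P` has at most as many vertices
as `Z`. -/
theorem vertex_surjection_from_zonotope {n : ℕ}
    (V : Finset (Fin n → ℝ)) (hV : V.Nonempty)
    (P : Set (Fin n → ℝ)) (hP : P = convexHull ℝ (V : Set (Fin n → ℝ)))
    (E : Finset (Fin n → ℝ))
    (hE : ∀ e : Set (Fin n → ℝ), IsEdge P e →
      ∃ g ∈ E, ∃ u ∈ e, ∃ v ∈ e, u ≠ v ∧ ∃ lam : ℝ, lam ≠ 0 ∧ g = lam • (u - v))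
    (Z : Set (Fin n → ℝ)) (hZ : Z = zone E)
    (gv : (Fin n → ℝ) → Fin n → ℝ)
    (hgv : ∀ v, IsVertex Z v → UniqueMax Z (gv v) v) :
    ∃ φ : (Fin n → ℝ) → Fin n → ℝ,
      (∀ v, IsVertex Z v → UniqueMax P (gv v) (φ v)) ∧
      (∀ u, IsVertex P u → ∃ v, IsVertex Z v ∧ φ v = u) ∧
      {u | IsVertex P u}.ncard ≤ {v | IsVertex Z v}.ncard := by
  subst hP hZ
  have hcard : ∀ w : Fin n → ℝ, (∀ e ∈ E, e ≠ 0 → w ⬝ᵥ e ≠ 0) → (argmaxOn V w).card ≤ 1 :=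
    fun w hw => card_argmaxOn_le_one hE hw
  have hex : ∀ v, IsVertex (zone E) v →
      ∃ u, UniqueMax (convexHull ℝ (V : Set (Fin n → ℝ))) (gv v) u := by
    intro v hv
    obtain ⟨u, hu⟩ := argmaxOn_nonempty hV (gv v)
    exact ⟨u, uniqueMax_of_mem_argmaxOn (hcard _ (hgv v hv).dotProduct_ne_zero_of_zone) hu⟩
  choose! φ hφ using hex
  have hsurj : ∀ u, IsVertex (convexHull ℝ (V : Set (Fin n → ℝ))) u →
      ∃ v, IsVertex (zone E) v ∧ φ v = u := by
    intro u hu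
    obtain ⟨w, huw, hgen⟩ := exists_generic_uniqueMax V E hV hu
    have hw := uniqueMax_zone_of_generic hgen
    have hv : IsVertex (zone E) (∑ e ∈ E, signChoice w e • e) := ⟨w, hw⟩
    have hg := hgv _ hv
    refine ⟨_, hv, (hφ _ hv).eq (uniqueMax_of_mem_argmaxOn
      (hcard _ hg.dotProduct_ne_zero_of_zone) ?_)⟩
    exact mem_argmaxOn_of_same_signs hV hcard (hg.same_signs_of_zone hw) huw
  refine ⟨φ, hφ, hsurj, ?_⟩
  have hfin := finite_vertices_zone E
  exact (Set.ncard_le_ncard (fun u hu => hsurj u hu) (hfin.image φ)).trans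
    (Set.ncard_image_le hfin)
end
end
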